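/- arXiv:1402.6377 — 2 statements merged into one kernel-verified Lean document; each statement's English description precedes it below -/
import Mathlib

section
/- Let d ≥ 2 and let f and f' be binary strings of length d−1. Then ν(f) = ν(f') if and only if the generalized Fibonacci cubes Q_d(f) and Q_d(f') are isomorphic. -/
/-- Two binary strings differ in exactly one position. -/
def cubeRel (v w : List Bool) : Prop :=
  (List.zipWith (fun a b => a != b) v w).count true = 1

/-- The generalized Fibonacci cube `Q_d(f)`: the subgraph of the `d`-cube induced on
binary strings of length `d` not containing `f` as a consecutive substring. -/
def genFib (d : ℕ) (f : List Bool) :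
    SimpleGraph {w : List Bool // w.length = d ∧ ¬ f <:+: w} :=
  SimpleGraph.fromRel fun v w => cubeRel v.1 w.1

/-- Hamming distance between binary strings (of equal length). -/
def hDist (v w : List Bool) : ℕ :=
  (List.zipWith (fun a b => a != b) v w).count true

/-- One less than the number of blocks of `f`: the number of indices `i ≥ 2`
with `f_{i-1} ≠ f_i`. -/
def nu (f : List Bool) : ℕ :=
  (List.zipWith (fun a b => a != b) f f.tail).count true

set_option linter.unusedSectionVars false

namespace FibAux

variable {ι : Type} [Fintype ι] [DecidableEq ι]

/-- The subgraph of the cube induced on the complement of `R`. -/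
def H (R : (ι → Bool) → Prop) : SimpleGraph {w : ι → Bool // ¬ R w} where
  Adj v w := hammingDist v.1 w.1 = 1
  symm := ⟨fun v w h => by rw [hammingDist_comm]; exact h⟩
  loopless := ⟨fun v h => by simp at h⟩

/-- The edge through `a` in direction `p`. -/
def E (p : ι) (a : ι → Bool) (w : ι → Bool) : Prop := ∀ i, i ≠ p → w i = a i

/-- Translation of the cube. -/
def tr (t w : ι → Bool) : ι → Bool := fun i => xor (w i) (t i)

lemma tr_tr (t w : ι → Bool) : tr t (tr t w) = w := by
  funext i; simp [tr]

lemma hd_tr (t v w : ι → Bool) : hammingDist (tr t v) (tr t w) = hammingDist v w := by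
  unfold hammingDist
  congr 1
  ext i
  simp [tr]

/-- Automorphism: permute coordinates, then translate. -/
def au (σ : Equiv.Perm ι) (t : ι → Bool) : (ι → Bool) ≃ (ι → Bool) where
  toFun w := tr t (fun i => w (σ i))
  invFun w := fun i => tr t w (σ.symm i)
  left_inv w := by funext i; simp [tr]
  right_inv w := by simp [tr_tr]

lemma hd_au (σ : Equiv.Perm ι) (t v w : ι → Bool) :
    hammingDist (au σ t v) (au σ t w) = hammingDist v w := by
  show hammingDist (tr t _) (tr t _) = _
  rw [hd_tr]
  unfold hammingDist
  apply Finset.card_equiv σ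
  intro i
  simp

lemma E_au (p : ι) (a a' : ι → Bool) (σ : Equiv.Perm ι) (t : ι → Bool) (hp : σ p = p)
    (h : ∀ i, xor (a (σ i)) (t i) = a' i) (w : ι → Bool) :
    E p a' (au σ t w) ↔ E p a w := by
  have hne : ∀ i, i ≠ p → σ i ≠ p := fun i hi h' => hi (σ.injective (h'.trans hp.symm))
  constructor
  · intro H i hi
    have hi' : σ.symm i ≠ p := by
      intro h'
      apply hi
      rw [← hp, ← h']; simp
    have := H _ hi'
    rw [← h] at this
    simpa [au, tr] using this
  · intro H i hi
    have := H _ (hne i hi)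
    rw [← h]
    simp [au, tr, this]

lemma exists_perm (p q : ι) (D D' : Finset ι) (h : D.card = D'.card)
    (hp : p ∉ D) (hq : q ∉ D) (hp' : p ∉ D') (hq' : q ∉ D') :
    ∃ σ : Equiv.Perm ι, σ p = p ∧ σ q = q ∧ ∀ i, σ i ∈ D' ↔ i ∈ D := by
  classical
  let P : ι → Prop := fun i => i ≠ p ∧ i ≠ q
  have key : ∀ F : Finset ι, p ∉ F → q ∉ F →
      Fintype.card {x : {i // P i} // x.1 ∈ F} = F.card := by
    intro F h1 h2
    rw [← Fintype.card_coe]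
    apply Fintype.card_congr
    exact {
      toFun := fun x => ⟨x.1.1, x.2⟩
      invFun := fun x => ⟨⟨x.1, fun h => h1 (h ▸ x.2), fun h => h2 (h ▸ x.2)⟩, x.2⟩
      left_inv := fun x => rfl
      right_inv := fun x => rfl }
  have hc : Fintype.card {x : {i // P i} // x.1 ∈ D} = Fintype.card {x : {i // P i} // x.1 ∈ D'} := by
    rw [key D hp hq, key D' hp' hq', h]
  let e := Fintype.equivOfCardEq hc
  let τ : Equiv.Perm {i // P i} := e.extendSubtype
  refine ⟨Equiv.Perm.ofSubtype τ, ?_, ?_, ?_⟩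
  · apply Equiv.Perm.ofSubtype_apply_of_not_mem; simp [P]
  · apply Equiv.Perm.ofSubtype_apply_of_not_mem; simp [P]
  · intro i
    by_cases hi : P i
    · rw [Equiv.Perm.ofSubtype_apply_of_mem _ hi]
      by_cases hD : i ∈ D
      · have := e.extendSubtype_mem ⟨i, hi⟩ hD
        exact ⟨fun _ => hD, fun _ => this⟩
      · have := e.extendSubtype_not_mem ⟨i, hi⟩ hD
        exact ⟨fun h => absurd h this, fun h => absurd h hD⟩
    · rw [Equiv.Perm.ofSubtype_apply_of_not_mem _ hi]
      have : i = p ∨ i = q := by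
        by_contra hh; push Not at hh; exact hi hh
      rcases this with rfl | rfl <;> simp [*]

theorem fwd (p q : ι) (a b a' b' : ι → Bool)
    (hp : a p = b p) (hq : a q = b q) (hp' : a' p = b' p) (hq' : a' q = b' q)
    (h : hammingDist a b = hammingDist a' b') :
    Nonempty (H (fun w => E p a w ∨ E q b w) ≃g H (fun w => E p a' w ∨ E q b' w)) := by
  obtain ⟨σ, h1, h2, h3⟩ := exists_perm p q (Finset.univ.filter fun i => a i ≠ b i)
    (Finset.univ.filter fun i => a' i ≠ b' i) h (by simp [hp]) (by simp [hq]) (by simp [hp'])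
    (by simp [hq'])
  obtain ⟨σ, h1, h2, h3⟩ : ∃ σ : Equiv.Perm ι, σ p = p ∧ σ q = q ∧
      ∀ i, a (σ i) ≠ b (σ i) ↔ a' i ≠ b' i := by
    refine ⟨σ.symm, ?_, ?_, ?_⟩
    · rw [Equiv.symm_apply_eq, h1]
    · rw [Equiv.symm_apply_eq, h2]
    · intro i
      have := h3 (σ.symm i)
      simpa using this.symm
  let t : ι → Bool := fun i => xor (a (σ i)) (a' i)
  have hA := E_au p a a' σ t h1 (fun i => by simp [t])
  have hB := E_au q b b' σ t h2 (fun i => by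
    have := h3 i
    simp only [t]
    revert this
    cases a (σ i) <;> cases b (σ i) <;> cases a' i <;> cases b' i <;> simp)
  refine ⟨⟨(au σ t).subtypeEquiv (fun w => ?_), ?_⟩⟩
  · rw [hA, hB]
  · intro v w
    show hammingDist (au σ t v.1) (au σ t w.1) = 1 ↔ hammingDist v.1 w.1 = 1
    rw [hd_au]

/-- `x` is a walk in the cube. -/
def IsW (k : ℕ) (x : Fin (k+1) → ι → Bool) : Prop :=
  ∀ i : Fin k, hammingDist (x i.castSucc) (x i.succ) = 1

lemma card_avoid (k : ℕ) (R R' : (ι → Bool) → Prop) (e : H R ≃g H R') :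
    Nat.card {x : Fin (k+1) → ι → Bool // IsW k x ∧ ∀ i, ¬ R (x i)} =
    Nat.card {x : Fin (k+1) → ι → Bool // IsW k x ∧ ∀ i, ¬ R' (x i)} := by
  apply Nat.card_congr
  exact {
    toFun := fun x => ⟨fun i => (e ⟨x.1 i, x.2.2 i⟩).1,
      fun i => e.map_adj_iff.2 (x.2.1 i), fun i => (e ⟨x.1 i, x.2.2 i⟩).2⟩
    invFun := fun x => ⟨fun i => (e.symm ⟨x.1 i, x.2.2 i⟩).1,
      fun i => e.symm.map_adj_iff.2 (x.2.1 i), fun i => (e.symm ⟨x.1 i, x.2.2 i⟩).2⟩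
    left_inv := fun x => by simp
    right_inv := fun x => by simp }

lemma card_hit (k : ℕ) (p : ι) (a a' : ι → Bool) :
    Nat.card {x : Fin (k+1) → ι → Bool // IsW k x ∧ ∃ i, E p a (x i)} =
    Nat.card {x : Fin (k+1) → ι → Bool // IsW k x ∧ ∃ i, E p a' (x i)} := by
  apply Nat.card_congr
  let g := au (Equiv.refl ι) (fun i => xor (a i) (a' i))
  have hg := E_au p a a' (Equiv.refl ι) (fun i => xor (a i) (a' i)) rfl (by simp)
  refine (Equiv.arrowCongr (Equiv.refl (Fin (k+1))) g).subtypeEquiv (fun x => ?_)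
  apply and_congr
  · apply forall_congr'
    intro i
    show _ ↔ hammingDist (au _ _ _) (au _ _ _) = 1
    rw [hd_au]; rfl
  · apply exists_congr
    intro i
    exact (hg (x i)).symm

lemma incl_excl {X : Type} [Finite X] (P A B : X → Prop) :
    Nat.card {x // P x ∧ ¬ A x ∧ ¬ B x} + Nat.card {x // P x ∧ A x} + Nat.card {x // P x ∧ B x}
    = Nat.card {x // P x} + Nat.card {x // P x ∧ A x ∧ B x} := by
  classical
  have := Fintype.ofFinite X
  simp only [Nat.card_eq_fintype_card, Fintype.card_subtype, Finset.card_filter,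
    ← Finset.sum_add_distrib]
  apply Finset.sum_congr rfl
  intro x _
  by_cases P x <;> by_cases A x <;> by_cases B x <;> simp [*]

lemma hd_E (p q : ι) (a b v w : ι → Bool) (hp : a p = b p) (hq : a q = b q)
    (hv : E p a v) (hw : E q b w) : hammingDist a b ≤ hammingDist v w := by
  unfold hammingDist
  apply Finset.card_le_card
  intro i
  simp only [Finset.mem_filter, Finset.mem_univ, true_and]
  intro h
  have h1 : i ≠ p := by rintro rfl; exact h hp
  have h2 : i ≠ q := by rintro rfl; exact h hq
  rwa [hv i h1, hw i h2]

lemma walk_le (k : ℕ) (x : Fin (k+1) → ι → Bool) (hx : IsW k x) :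
    ∀ n, ∀ i j : Fin (k+1), i.1 + n = j.1 → hammingDist (x i) (x j) ≤ n := by
  intro n
  induction n with
  | zero =>
    intro i j h
    have : i = j := Fin.ext h
    simp [this]
  | succ n ih =>
    intro i j h
    have hj := j.2
    let j0 : Fin k := ⟨i.1 + n, by omega⟩
    have e : j = j0.succ := Fin.ext (by simp [j0]; omega)
    have h1 := ih i j0.castSucc rfl
    have h2 := hx j0
    have h3 := hammingDist_triangle (x i) (x j0.castSucc) (x j0.succ)
    rw [e]; omega

lemma exists_walk : ∀ n, ∀ a b : ι → Bool, hammingDist a b = n →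
    ∃ x : ℕ → ι → Bool, x 0 = a ∧ x n = b ∧ ∀ i < n, hammingDist (x i) (x (i+1)) = 1 := by
  intro n
  induction n with
  | zero =>
    intro a b h
    exact ⟨fun _ => a, rfl, hammingDist_eq_zero.1 h, by simp⟩
  | succ n ih =>
    intro a b h
    have hne : (Finset.univ.filter fun i => a i ≠ b i).Nonempty := by
      rw [← Finset.card_pos]
      show 0 < hammingDist a b
      omega
    obtain ⟨j, hj⟩ := hne
    let c := Function.update a j (b j)
    have hac : hammingDist a c = 1 := by
      unfold hammingDist
      rw [Finset.card_eq_one]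
      refine ⟨j, ?_⟩
      ext i
      by_cases hi : i = j
      · subst hi; simpa [c] using hj
      · simp [c, hi]
    have hcb : hammingDist c b = n := by
      have : (Finset.univ.filter fun i => c i ≠ b i) =
          (Finset.univ.filter fun i => a i ≠ b i).erase j := by
        ext i
        by_cases hi : i = j
        · subst hi; simp [c]
        · simp [c, hi]
      unfold hammingDist
      rw [this, Finset.card_erase_of_mem hj]
      have h' : (Finset.univ.filter fun i => a i ≠ b i).card = n + 1 := h
      omega
    obtain ⟨x, h0, h1, h2⟩ := ih c b hcb
    refine ⟨fun i => if i = 0 then a else x (i-1), by simp, by simp [h1], ?_⟩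
    intro i hi
    rcases i with _ | i
    · simp [h0, hac]
    · simpa using h2 i (by omega)

theorem not_lt (p q : ι) (a b a' b' : ι → Bool)
    (hp' : a' p = b' p) (hq' : a' q = b' q)
    (e : H (fun w => E p a w ∨ E q b w) ≃g H (fun w => E p a' w ∨ E q b' w)) :
    ¬ hammingDist a b < hammingDist a' b' := by
  intro hlt
  set k := hammingDist a b with hk
  have h0 := card_avoid k _ _ e
  have h1 := incl_excl (IsW k) (fun x => ∃ i, E p a (x i)) (fun x => ∃ i, E q b (x i))
  have h2 := incl_excl (IsW k) (fun x => ∃ i, E p a' (x i)) (fun x => ∃ i, E q b' (x i))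
  have h3 := card_hit k p a a'
  have h4 := card_hit k q b b'
  simp only [not_or, forall_and] at h0
  simp only [not_exists] at h1 h2
  have h5 : 0 < Nat.card {x // IsW k x ∧ (∃ i, E p a (x i)) ∧ (∃ i, E q b (x i))} := by
    rw [Nat.card_pos_iff]
    refine ⟨?_, inferInstance⟩
    obtain ⟨x, hx0, hxk, hx⟩ := exists_walk k a b rfl
    refine ⟨⟨fun i => x i.1, fun i => hx i.1 i.2, ⟨0, ?_⟩, ⟨Fin.last k, ?_⟩⟩⟩
    · intro i _; simp [hx0]
    · intro i _; simp [hxk]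
  have h6 : Nat.card {x // IsW k x ∧ (∃ i, E p a' (x i)) ∧ (∃ i, E q b' (x i))} = 0 := by
    rw [Nat.card_eq_zero]
    left
    refine ⟨fun ⟨x, hx, ⟨i, hi⟩, ⟨j, hj⟩⟩ => ?_⟩
    have hle := hd_E p q a' b' _ _ hp' hq' hi hj
    have := i.2
    have := j.2
    rcases le_total i.1 j.1 with hij | hij
    · have := walk_le k x hx (j.1 - i.1) i j (by omega)
      omega
    · have := walk_le k x hx (i.1 - j.1) j i (by omega)
      rw [hammingDist_comm] at this
      omega
  omega

theorem main (p q : ι) (a b a' b' : ι → Bool)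
    (hp : a p = b p) (hq : a q = b q) (hp' : a' p = b' p) (hq' : a' q = b' q) :
    hammingDist a b = hammingDist a' b' ↔
    Nonempty (H (fun w => E p a w ∨ E q b w) ≃g H (fun w => E p a' w ∨ E q b' w)) := by
  constructor
  · exact fwd p q a b a' b' hp hq hp' hq'
  · rintro ⟨e⟩
    have := not_lt p q a b a' b' hp' hq' e
    have := not_lt p q a' b' a b hp hq e.symm
    omega

lemma hDist_ofFn : ∀ (n : ℕ) (v w : Fin n → Bool),
    hDist (List.ofFn v) (List.ofFn w) = hammingDist v w := by
  intro n
  induction n with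
  | zero => intro v w; simp [hDist, hammingDist]
  | succ n ih =>
    intro v w
    have := ih (fun i => v i.succ) (fun i => w i.succ)
    unfold hDist hammingDist at *
    rw [List.ofFn_succ, List.ofFn_succ, List.zipWith_cons_cons, List.count_cons, this,
      Finset.card_filter, Finset.card_filter, Fin.sum_univ_succ, add_comm]
    congr 1
    by_cases h : v 0 = w 0 <;> simp [h]

lemma nu_eq : ∀ (l : List Bool) (x y : Bool), l.head? = some x → l.getLast? = some y →
    hDist (x :: l) (l ++ [y]) = nu l := by
  have key : ∀ (l : List Bool) (x y : Bool), (x :: l).getLast? = some y →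
      hDist (x :: l) (l ++ [y]) = nu (x :: l) := by
    intro l
    induction l with
    | nil => intro x y h; simp at h; simp [h, hDist, nu]
    | cons z l ih =>
      intro x y h
      have := ih z y (by simpa using h)
      simp only [hDist, nu, List.tail_cons, List.cons_append, List.zipWith_cons_cons,
        List.count_cons] at *
      rw [this]
  intro l x y hx hy
  cases l with
  | nil => simp at hx
  | cons z l =>
    simp at hx
    subst hx
    have := key l z y hy
    unfold hDist at *
    simp only [List.cons_append, List.zipWith_cons_cons, List.count_cons, this]
    simp

lemma infix_iff (f w : List Bool) (h : w.length = f.length + 1) :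
    f <:+: w ↔ (∃ x, w = x :: f) ∨ ∃ y, w = f ++ [y] := by
  constructor
  · rintro ⟨s, t, rfl⟩
    simp at h
    rcases s with _ | ⟨x, s⟩
    · right
      simp at h
      obtain ⟨y, rfl⟩ := List.length_eq_one_iff.1 h
      exact ⟨y, by simp⟩
    · left
      simp at h
      have h1 : s = [] := List.length_eq_zero_iff.1 (by omega)
      have h2 : t = [] := List.length_eq_zero_iff.1 (by omega)
      exact ⟨x, by simp [h1, h2]⟩
  · rintro (⟨x, rfl⟩ | ⟨y, rfl⟩)
    · exact ⟨[x], [], by simp⟩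
    · exact ⟨[], [y], by simp⟩

lemma infix_ofFn (m : ℕ) (g : Fin (m+1) → Bool) (w : Fin (m+2) → Bool) :
    List.ofFn g <:+: List.ofFn w ↔
    E 0 (Fin.cons (g 0) g : Fin (m+2) → Bool) w ∨
    E (Fin.last (m+1)) (Fin.snoc g (g (Fin.last m)) : Fin (m+2) → Bool) w := by
  rw [infix_iff _ _ (by simp)]
  apply or_congr
  · constructor
    · rintro ⟨x, hx⟩ i hi
      rw [List.ofFn_succ] at hx
      have := List.ofFn_injective (List.cons.inj hx).2
      obtain ⟨j, rfl⟩ := Fin.exists_succ_eq.2 hi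
      simpa using congrFun this j
    · intro h
      refine ⟨w 0, ?_⟩
      rw [List.ofFn_succ]
      congr 2
      funext i
      simpa using h i.succ (Fin.succ_ne_zero i)
  · constructor
    · rintro ⟨x, hx⟩ i hi
      rw [List.ofFn_succ_last] at hx
      have := List.ofFn_injective (List.append_inj hx (by simp)).1
      obtain ⟨j, rfl⟩ := Fin.exists_castSucc_eq.2 hi
      simpa using congrFun this j
    · intro h
      refine ⟨w (Fin.last _), ?_⟩
      rw [List.ofFn_succ_last]
      congr 2
      funext i
      simpa using h i.castSucc (Fin.castSucc_lt_last i).ne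

lemma nu_ofFn (m : ℕ) (g : Fin (m+1) → Bool) :
    hammingDist (Fin.cons (g 0) g : Fin (m+2) → Bool) (Fin.snoc g (g (Fin.last m)))
      = nu (List.ofFn g) := by
  rw [← hDist_ofFn, ← nu_eq (List.ofFn g) (g 0) (g (Fin.last m))]
  · congr 1
    · rw [List.ofFn_succ]; simp
    · rw [List.ofFn_succ_last]; simp
  · rw [List.ofFn_succ]; simp
  · rw [List.ofFn_succ_last]; simp

/-- Functions versus lists. -/
noncomputable def eqv (d : ℕ) (f : List Bool) :
    {w : Fin d → Bool // ¬ f <:+: List.ofFn w} ≃ {w : List Bool // w.length = d ∧ ¬ f <:+: w} :=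
  Equiv.ofBijective (fun w => ⟨List.ofFn w.1, by simp, w.2⟩)
    ⟨fun v w h => Subtype.ext (List.ofFn_injective (congrArg Subtype.val h)),
     fun ⟨w, hw, hf⟩ => by
      subst hw
      exact ⟨⟨w.get, by simpa using hf⟩, by simp⟩⟩

/-- The function model of the generalized Fibonacci cube. -/
noncomputable def isoH (d : ℕ) (f : List Bool) :
    H (fun w : Fin d → Bool => f <:+: List.ofFn w) ≃g genFib d f where
  toEquiv := eqv d f
  map_rel_iff' := by
    intro v w
    show _ ↔ hammingDist v.1 w.1 = 1
    have h1 := hDist_ofFn d v.1 w.1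
    have h2 := hDist_ofFn d w.1 v.1
    unfold hDist at h1 h2
    rw [genFib, SimpleGraph.fromRel_adj]
    change (eqv d f v ≠ eqv d f w ∧
      ((List.zipWith (fun a b => a != b) (List.ofFn v.1) (List.ofFn w.1)).count true = 1 ∨
       (List.zipWith (fun a b => a != b) (List.ofFn w.1) (List.ofFn v.1)).count true = 1)) ↔ _
    rw [h1, h2, hammingDist_comm w.1 v.1, or_self]
    constructor
    · exact fun h => h.2
    · intro h
      refine ⟨?_, h⟩
      intro h'
      rw [(eqv d f).injective h'] at h
      simp at h

/-- Equal forbidden sets give isomorphic graphs. -/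
def isoCongr {R R' : (ι → Bool) → Prop} (h : R = R') : H R ≃g H R' := by
  subst h
  exact SimpleGraph.Iso.refl

end FibAux

theorem stmt2 (d : ℕ) (hd : 2 ≤ d) (f f' : List Bool)
    (hf : f.length = d - 1) (hf' : f'.length = d - 1) :
    nu f = nu f' ↔ Nonempty (genFib d f ≃g genFib d f') := by
  obtain ⟨m, rfl⟩ : ∃ m, d = m + 2 := ⟨d - 2, by omega⟩
  have conv : ∀ f : List Bool, f.length = m + 2 - 1 → ∃ g : Fin (m+1) → Bool, f = List.ofFn g := by
    intro f hf
    have hf : f.length = m + 1 := hf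
    rw [← hf]
    exact ⟨f.get, by simp⟩
  obtain ⟨g, rfl⟩ := conv f hf
  obtain ⟨g', rfl⟩ := conv f' hf'
  have e := (FibAux.isoH (m+2) (List.ofFn g)).symm.trans
    (FibAux.isoCongr (funext fun w => propext (FibAux.infix_ofFn m g w)))
  have e' := (FibAux.isoH (m+2) (List.ofFn g')).symm.trans
    (FibAux.isoCongr (funext fun w => propext (FibAux.infix_ofFn m g' w)))
  have h0 : ∀ g : Fin (m+1) → Bool, (Fin.cons (g 0) g : Fin (m+2) → Bool) 0 =
      (Fin.snoc g (g (Fin.last m)) : Fin (m+2) → Bool) 0 := by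
    intro g
    have := Fin.snoc_castSucc (α := fun _ => Bool) (g (Fin.last m)) g 0
    rw [Fin.castSucc_zero] at this
    rw [this, Fin.cons_zero]
  have h1 : ∀ g : Fin (m+1) → Bool, (Fin.cons (g 0) g : Fin (m+2) → Bool) (Fin.last (m+1)) =
      (Fin.snoc g (g (Fin.last m)) : Fin (m+2) → Bool) (Fin.last (m+1)) := by
    intro g
    rw [Fin.snoc_last, ← Fin.succ_last, Fin.cons_succ]
  rw [← FibAux.nu_ofFn, ← FibAux.nu_ofFn,
    FibAux.main 0 (Fin.last (m+1)) _ _ _ _ (h0 g) (h1 g) (h0 g') (h1 g')]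
  exact ⟨fun ⟨x⟩ => ⟨(e.trans x).trans e'.symm⟩, fun ⟨x⟩ => ⟨(e.symm.trans x).trans e'⟩⟩
end

section
/- Let d ≥ 2 and let f be a binary string of length d−1 with ν(f) = 1. Then the generalized Fibonacci cube Q_d(f) has exactly d·2^{d−1} − (4d − 3) edges. -/
lemma hDist_cons (a b : Bool) (v w : List Bool) :
    hDist (a :: v) (b :: w) = (if a = b then 0 else 1) + hDist v w := by
  cases a <;> cases b <;> simp [hDist, Nat.add_comm]

lemma hDist_self (v : List Bool) : hDist v v = 0 := by
  induction v with
  | nil => rfl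
  | cons a v ih => simp [hDist_cons, ih]

lemma hDist_comm (v : List Bool) : ∀ w : List Bool, hDist v w = hDist w v := by
  induction v with
  | nil => intro w; cases w <;> rfl
  | cons a v ih =>
    intro w
    cases w with
    | nil => rfl
    | cons b w => rw [hDist_cons, hDist_cons, ih w]; simp only [eq_comm]

lemma hDist_zero (v : List Bool) : ∀ w : List Bool, w.length = v.length →
    (hDist v w = 0 ↔ w = v) := by
  induction v with
  | nil => intro w h; simp at h; subst h; simp [hDist]
  | cons a v ih =>
    intro w h
    cases w with
    | nil => simp at h
    | cons b w =>
      simp only [List.length_cons, Nat.add_right_cancel_iff] at h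
      rw [hDist_cons]
      have := ih w h
      by_cases hab : a = b
      · subst hab; simp [this]
      · have : b ≠ a := fun h => hab h.symm
        simp [hab, this]

lemma hDist_append_last (g : List Bool) : ∀ w (a b : Bool), w.length = g.length →
    hDist (g ++ [a]) (w ++ [b]) = hDist g w + (if a = b then 0 else 1) := by
  induction g with
  | nil =>
    intro w a b h
    simp at h; subst h; cases a <;> cases b <;> rfl
  | cons c g ih =>
    intro w a b h
    cases w with
    | nil => simp at h
    | cons e w =>
      simp only [List.length_cons, Nat.add_right_cancel_iff] at h
      simp only [List.cons_append, hDist_cons, ih w a b h, Nat.add_assoc]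

lemma nu_cons (c : Bool) (g : List Bool) : nu (c :: g) = hDist (c :: g) g := rfl

lemma exists_last (g : List Bool) : ∀ c : Bool, ∃ e : Bool, ∀ y,
    hDist (c :: g) (g ++ [y]) = nu (c :: g) + (if e = y then 0 else 1) := by
  induction g with
  | nil => intro c; exact ⟨c, fun y => by cases c <;> cases y <;> rfl⟩
  | cons b g ih =>
    intro c
    obtain ⟨e, he⟩ := ih b
    refine ⟨e, fun y => ?_⟩
    rw [List.cons_append, hDist_cons, he y, nu_cons c, hDist_cons, nu_cons, Nat.add_assoc]

/-- all strings of length `n` -/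
def allL : ℕ → Finset (List Bool)
  | 0 => {[]}
  | n + 1 => (allL n).image (List.cons true) ∪ (allL n).image (List.cons false)

lemma mem_allL (n : ℕ) : ∀ w, w ∈ allL n ↔ w.length = n := by
  induction n with
  | zero => intro w; simp [allL]
  | succ n ih =>
    intro w
    cases w with
    | nil => simp [allL]
    | cons a w => cases a <;> simp [allL, ih]

lemma card_allL (n : ℕ) : (allL n).card = 2 ^ n := by
  induction n with
  | zero => rfl
  | succ n ih =>
    rw [allL, Finset.card_union_of_disjoint, Finset.card_image_of_injective _ List.cons_injective,
      Finset.card_image_of_injective _ List.cons_injective, ih]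
    · ring
    · rw [Finset.disjoint_left]
      intro w h1 h2
      simp only [Finset.mem_image] at h1 h2
      obtain ⟨u, _, rfl⟩ := h1
      obtain ⟨v, _, h⟩ := h2
      simp at h

/-- neighbours in the cube -/
def nbrs : List Bool → Finset (List Bool)
  | [] => ∅
  | a :: v => insert ((!a) :: v) ((nbrs v).image (List.cons a))

lemma mem_nbrs (v : List Bool) : ∀ w, w ∈ nbrs v ↔ w.length = v.length ∧ hDist v w = 1 := by
  induction v with
  | nil => intro w; simp [nbrs, hDist]
  | cons a v ih =>
    intro w
    cases w with
    | nil => simp [nbrs]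
    | cons b w =>
      have h0 := hDist_zero v w
      rw [hDist_cons]
      simp only [nbrs, Finset.mem_insert, Finset.mem_image, ih, List.cons.injEq, List.length_cons,
        Nat.add_right_cancel_iff]
      by_cases hab : a = b
      · subst hab; simp
      · have hb : b = !a := by cases a <;> cases b <;> simp_all
        subst hb
        simp
        constructor
        · rintro rfl; simp [hDist_self]
        · rintro ⟨h1, h2⟩; exact (h0 h1).1 h2

lemma card_nbrs (v : List Bool) : (nbrs v).card = v.length := by
  induction v with
  | nil => rfl
  | cons a v ih =>
    rw [nbrs, Finset.card_insert_of_notMem,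
      Finset.card_image_of_injective _ List.cons_injective, ih]; rfl
    simp

lemma infix_iff (f w : List Bool) (h : w.length = f.length + 1) :
    f <:+: w ↔ (∃ x, w = x :: f) ∨ ∃ y, w = f ++ [y] := by
  constructor
  · rintro ⟨s, t, rfl⟩
    simp at h
    rcases s with _ | ⟨x, s⟩
    · right
      have : t.length = 1 := by simp at h; omega
      obtain ⟨y, rfl⟩ := List.length_eq_one_iff.1 this
      exact ⟨y, by simp⟩
    · left
      simp at h
      have h1 : s = [] := List.length_eq_zero_iff.1 (by omega)
      have h2 : t = [] := List.length_eq_zero_iff.1 (by omega)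
      subst h1 h2
      exact ⟨x, by simp⟩
  · rintro (⟨x, rfl⟩ | ⟨y, rfl⟩)
    · exact (List.suffix_cons x f).isInfix
    · exact (List.prefix_append f [y]).isInfix

/-- the four strings containing `f` -/
lemma badSet (c : Bool) (g : List Bool) (hnu : nu (c :: g) = 1) :
    ∃ S : Finset (List Bool), S.card = 4 ∧
      (∀ w : List Bool, w ∈ S ↔ w.length = g.length + 2 ∧ (c :: g) <:+: w) ∧
      ((S ×ˢ S).filter fun p => hDist p.1 p.2 = 1).card = 6 := by
  obtain ⟨e, he⟩ := exists_last g c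
  rw [hnu] at he
  set f := c :: g with hf
  have key : ∀ x y, hDist (x :: f) (f ++ [y])
      = (if x = c then 0 else 1) + (1 + if e = y then 0 else 1) := by
    intro x y
    rw [← he y, hf, List.cons_append, hDist_cons]
  have key' : ∀ x y, hDist (f ++ [y]) (x :: f)
      = (if x = c then 0 else 1) + (1 + if e = y then 0 else 1) := by
    intro x y
    rw [hDist_comm, key]
  have ne : ∀ x y, x :: f ≠ f ++ [y] := by
    intro x y h
    have := key x y
    rw [← h, hDist_self] at this
    omega
  have ne' : ∀ x y, f ++ [y] ≠ x :: f := fun x y h => ne x y h.symm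
  have d1 : ∀ x y, hDist (x :: f) (y :: f) = if x = y then 0 else 1 := by
    intro x y; rw [hDist_cons, hDist_self, Nat.add_zero]
  have d2 : ∀ x y, hDist (f ++ [x]) (f ++ [y]) = if x = y then 0 else 1 := by
    intro x y; rw [hDist_append_last _ _ _ _ rfl, hDist_self, Nat.zero_add]
  have n1 : c :: f ∉ ({(!c) :: f, f ++ [e], f ++ [!e]} : Finset (List Bool)) := by
    simp [ne]
  have n2 : (!c) :: f ∉ ({f ++ [e], f ++ [!e]} : Finset (List Bool)) := by
    simp [ne]
  have n3 : f ++ [e] ∉ ({f ++ [!e]} : Finset (List Bool)) := by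
    simp
  refine ⟨{c :: f, (!c) :: f, f ++ [e], f ++ [!e]}, ?_, ?_, ?_⟩
  · rw [Finset.card_insert_of_notMem n1, Finset.card_insert_of_notMem n2,
      Finset.card_insert_of_notMem n3, Finset.card_singleton]
  · intro w
    have hl : f.length = g.length + 1 := by simp [hf]
    clear_value f
    constructor
    · intro h
      simp only [Finset.mem_insert, Finset.mem_singleton] at h
      have hw : w.length = g.length + 2 := by
        rcases h with rfl | rfl | rfl | rfl <;> simp [hl]
      refine ⟨hw, (infix_iff f w (by omega)).2 ?_⟩
      rcases h with h | h | h | h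
      · exact Or.inl ⟨_, h⟩
      · exact Or.inl ⟨_, h⟩
      · exact Or.inr ⟨_, h⟩
      · exact Or.inr ⟨_, h⟩
    · rintro ⟨hw, h⟩
      simp only [Finset.mem_insert, Finset.mem_singleton]
      rcases (infix_iff f w (by omega)).1 h with ⟨x, rfl⟩ | ⟨y, rfl⟩
      · have : x = c ∨ x = !c := by cases x <;> cases c <;> simp
        rcases this with rfl | rfl <;> simp
      · have : y = e ∨ y = !e := by cases y <;> cases e <;> simp
        rcases this with rfl | rfl <;> simp
  · clear_value f
    rw [Finset.card_filter, Finset.sum_product]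
    simp only [Finset.sum_insert n1, Finset.sum_insert n2, Finset.sum_insert n3,
      Finset.sum_singleton, key, key', d1, d2]
    cases c <;> cases e <;> simp

lemma sum_card (T : Finset (List Bool)) (d : ℕ) (hT : ∀ w ∈ T, w.length = d) :
    ((T ×ˢ allL d).filter fun p => hDist p.1 p.2 = 1).card = T.card * d := by
  rw [Finset.card_filter, Finset.sum_product, ← smul_eq_mul, ← Finset.sum_const]
  refine Finset.sum_congr rfl fun v hv => ?_
  rw [← Finset.card_filter, ← hT v hv, ← card_nbrs v]
  congr 1
  ext w
  simp [mem_nbrs, mem_allL, card_nbrs]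

lemma count_good (d : ℕ) (S : Finset (List Bool)) (hS : S ⊆ allL d) :
    ((((allL d \ S) ×ˢ (allL d \ S)).filter fun p => hDist p.1 p.2 = 1).card : ℤ)
      = 2 ^ d * d - 2 * (S.card * d) + ((S ×ˢ S).filter fun p => hDist p.1 p.2 = 1).card := by
  have hA := sum_card (allL d) d (fun w hw => (mem_allL d w).1 hw)
  have hB := sum_card S d (fun w hw => (mem_allL d w).1 (hS hw))
  rw [card_allL] at hA
  have hC : ((allL d ×ˢ S).filter fun p => hDist p.1 p.2 = 1).card = S.card * d := by
    rw [← hB]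
    refine Finset.card_bij' (fun p _ => p.swap) (fun p _ => p.swap) ?_ ?_ ?_ ?_
    · intro p; simp only [Finset.mem_filter, Finset.mem_product, Prod.fst_swap, Prod.snd_swap]
      rw [hDist_comm]; tauto
    · intro p; simp only [Finset.mem_filter, Finset.mem_product, Prod.fst_swap, Prod.snd_swap]
      rw [hDist_comm]; tauto
    · simp
    · simp
  have split : ∀ T U : Finset (List Bool), T ⊆ U → ∀ F : List Bool → ℤ,
      ∑ v ∈ U \ T, F v = ∑ v ∈ U, F v - ∑ v ∈ T, F v := by
    intro T U h F
    rw [← Finset.sum_sdiff h]; ring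
  have conv : ∀ T U : Finset (List Bool),
      ((((T ×ˢ U).filter fun p => hDist p.1 p.2 = 1).card : ℕ) : ℤ)
        = ∑ v ∈ T, ∑ w ∈ U, if hDist v w = 1 then 1 else 0 := by
    intro T U
    rw [Finset.card_filter, Finset.sum_product]; push_cast; rfl
  have hA' := congrArg (Nat.cast : ℕ → ℤ) hA
  have hB' := congrArg (Nat.cast : ℕ → ℤ) hB
  have hC' := congrArg (Nat.cast : ℕ → ℤ) hC
  rw [conv] at hA' hB' hC' ⊢
  rw [conv]
  simp only [split S (allL d) hS, Finset.sum_sub_distrib]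
  rw [hA', hB', hC']
  push_cast
  ring

theorem stmt16 (d : ℕ) (hd : 2 ≤ d) (f : List Bool) (hf : f.length = d - 1)
    (hnu : nu f = 1) :
    ((genFib d f).edgeSet.ncard : ℤ) = d * 2 ^ (d - 1) - (4 * d - 3) := by
  classical
  obtain ⟨c, g, rfl⟩ : ∃ c g, f = c :: g := by
    cases f with
    | nil => simp [nu] at hnu
    | cons c g => exact ⟨c, g, rfl⟩
  obtain ⟨S, hS4, hSm, hS6⟩ := badSet c g hnu
  have hg : g.length + 2 = d := by simp at hf; omega
  rw [hg] at hSm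
  have hSsub : S ⊆ allL d := fun w hw => (mem_allL d w).2 ((hSm w).1 hw).1
  have hcount := count_good d S hSsub
  rw [hS4, hS6] at hcount
  have hmem : ∀ w, w ∈ allL d \ S ↔ (w.length = d ∧ ¬ (c :: g) <:+: w) := by
    intro w
    rw [Finset.mem_sdiff, mem_allL, hSm]; tauto
  haveI : Finite {w : List Bool // w.length = d ∧ ¬ (c :: g) <:+: w} := by
    refine Set.Finite.to_subtype ((allL d \ S).finite_toSet.subset ?_)
    intro w hw
    exact (hmem w).2 hw
  haveI : Fintype {w : List Bool // w.length = d ∧ ¬ (c :: g) <:+: w} := Fintype.ofFinite _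
  have hadj : ∀ v w, (genFib d (c :: g)).Adj v w ↔ hDist v.1 w.1 = 1 := by
    intro v w
    simp only [genFib, SimpleGraph.fromRel_adj]
    change v ≠ w ∧ (hDist v.1 w.1 = 1 ∨ hDist w.1 v.1 = 1) ↔ _
    rw [hDist_comm w.1 v.1, or_self]
    refine ⟨fun h => h.2, fun h => ⟨?_, h⟩⟩
    rintro rfl
    rw [hDist_self] at h
    omega
  have hdart : Fintype.card (genFib d (c :: g)).Dart
      = (((allL d \ S) ×ˢ (allL d \ S)).filter fun p => hDist p.1 p.2 = 1).card := by
    rw [← Finset.card_univ]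
    refine Finset.card_bij (fun D _ => (D.fst.1, D.snd.1)) ?_ ?_ ?_
    · intro D _
      rw [Finset.mem_filter, Finset.mem_product]
      exact ⟨⟨(hmem _).2 D.fst.2, (hmem _).2 D.snd.2⟩, (hadj _ _).1 D.adj⟩
    · intro D _ E _ h
      rw [Prod.mk.injEq] at h
      exact SimpleGraph.Dart.ext _ _ (Prod.ext (Subtype.ext h.1) (Subtype.ext h.2))
    · rintro ⟨v, w⟩ h
      rw [Finset.mem_filter, Finset.mem_product] at h
      exact ⟨⟨(⟨v, (hmem v).1 h.1.1⟩, ⟨w, (hmem w).1 h.1.2⟩), (hadj _ _).2 h.2⟩,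
        Finset.mem_univ _, rfl⟩
  have h2 := (genFib d (c :: g)).dart_card_eq_twice_card_edges
  rw [hdart] at h2
  rw [h2] at hcount
  have h3 : (genFib d (c :: g)).edgeSet.ncard = (genFib d (c :: g)).edgeFinset.card := by
    rw [← SimpleGraph.coe_edgeFinset, Set.ncard_coe_finset]
  rw [h3]
  obtain ⟨k, rfl⟩ : ∃ k, d = k + 1 := ⟨d - 1, by omega⟩
  simp only [Nat.add_sub_cancel]
  push_cast at hcount ⊢
  rw [pow_succ] at hcount
  linarith
end
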